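/- arXiv:math/0211305 — 2 statements merged into one kernel-verified Lean document; each statement's English description precedes it below -/
import Mathlib

section
/- Let d, N be positive integers, let m ≥ 0, k ∈ ℝ, and μ > 0. Let f : ℂ → ℂ be a symbol of order k on ℂ, and let a : ℝ^d × ℝ^N → ℂ be a symbol of type (1,0) and order m which is μ-elliptic. Then the composition f ∘ a : ℝ^d × ℝ^N → ℂ is a symbol of type (1,0) and order m·k. -/
/-- `⟨ξ⟩ := (1 + ‖ξ‖²)^{1/2}`. -/
noncomputable def jap {N : ℕ} (ξ : EuclideanSpace ℝ (Fin N)) : ℝ :=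
  (1 + ‖ξ‖ ^ 2) ^ ((1 : ℝ) / 2)

/-- `a : ℝ^d × ℝ^N → F` is a symbol of type `(1,0)` and order `m`:
it is smooth, and for all `j, l` the iterated derivative of order `j` in `x`
and order `l` in `ξ` is bounded by `C(j,l) ⟨ξ⟩^{m-l}`. -/
def IsSymbol (d N : ℕ) (m : ℝ) {F : Type*} [NormedAddCommGroup F] [NormedSpace ℝ F]
    (a : EuclideanSpace ℝ (Fin d) → EuclideanSpace ℝ (Fin N) → F) : Prop :=
  ContDiff ℝ (⊤ : ℕ∞)
      (fun p : EuclideanSpace ℝ (Fin d) × EuclideanSpace ℝ (Fin N) => a p.1 p.2) ∧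
    ∀ j l : ℕ, ∃ C : ℝ, ∀ (x : EuclideanSpace ℝ (Fin d)) (ξ : EuclideanSpace ℝ (Fin N)),
      ‖iteratedFDeriv ℝ j (fun x' => iteratedFDeriv ℝ l (fun ξ' => a x' ξ') ξ) x‖ ≤
        C * jap ξ ^ (m - l)

/-- `f : ℂ → ℂ` is a symbol of order `k` on `ℂ`: it is smooth (as a function of two
real variables), and `‖D^j f (w)‖ ≤ C(j) ⟨w⟩^{k - j}` for all `w`. -/
def IsSymbolOnC (k : ℝ) (f : ℂ → ℂ) : Prop :=
  ContDiff ℝ (⊤ : ℕ∞) f ∧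
    ∀ j : ℕ, ∃ C : ℝ, ∀ w : ℂ,
      ‖iteratedFDeriv ℝ j f w‖ ≤ C * ((1 + ‖w‖ ^ 2) ^ ((1 : ℝ) / 2)) ^ (k - j)

section
variable {E F G : Type*} [NormedAddCommGroup E] [NormedSpace ℝ E] [NormedAddCommGroup F] [NormedSpace ℝ F]
  [NormedAddCommGroup G] [NormedSpace ℝ G]

theorem ifd_succ {f : E → F} (hf : ContDiff ℝ (⊤ : ℕ∞) f) (n : ℕ) (x : E) (v : Fin (n+1) → E) :
    iteratedFDeriv ℝ (n+1) f x v = fderiv ℝ (fun y => iteratedFDeriv ℝ n f y (Fin.tail v)) x (v 0) := by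
  apply DifferentiableAt.iteratedFDeriv_succ_apply_left'
  exact (hf.differentiable_iteratedFDeriv (WithTop.coe_lt_coe.2 (WithTop.coe_lt_top n))).differentiableAt

theorem ifd_contDiff {f : E → F} (hf : ContDiff ℝ (⊤ : ℕ∞) f) (n : ℕ) (v : Fin n → E) :
    ContDiff ℝ (⊤ : ℕ∞) (fun y => iteratedFDeriv ℝ n f y v) := by
  have h : ContDiff ℝ (⊤ : ℕ∞) (iteratedFDeriv ℝ n f) := hf.iteratedFDeriv_right (by exact_mod_cast le_top)
  exact (ContinuousMultilinearMap.apply ℝ (fun _ : Fin n => E) F v).contDiff.comp h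

theorem ifd_swap {f : E → F} (hf : ContDiff ℝ (⊤ : ℕ∞) f) (n : ℕ) (i : Fin n) (x : E)
    (v : Fin (n+1) → E) :
    iteratedFDeriv ℝ (n+1) f x (v ∘ Equiv.swap i.castSucc i.succ) = iteratedFDeriv ℝ (n+1) f x v := by
  induction n generalizing x with
  | zero => exact i.elim0
  | succ n ih =>
    induction i using Fin.cases with
    | zero =>
      have key : ∀ w : Fin (n+1+1) → E, iteratedFDeriv ℝ (n+1+1) f x w =
          fderiv ℝ (fderiv ℝ (fun y => iteratedFDeriv ℝ n f y (Fin.tail (Fin.tail w)))) x (w 0) (w 1) := by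
        intro w
        rw [ifd_succ hf]
        have hc := ifd_contDiff hf n (Fin.tail (Fin.tail w))
        have : (fun y => iteratedFDeriv ℝ (n+1) f y (Fin.tail w)) = fun y =>
          fderiv ℝ (fun y => iteratedFDeriv ℝ n f y (Fin.tail (Fin.tail w))) y (w 1) := by
          funext y
          rw [ifd_succ hf]; rfl
        rw [this, fderiv_clm_apply]
        · simp
        · exact ((hc.fderiv_right (m := 1) (by exact WithTop.coe_le_coe.2 le_top)).differentiable (by simp)).differentiableAt
        · simp
      rw [key, key]
      have ht : Fin.tail (Fin.tail (v ∘ Equiv.swap (Fin.castSucc 0) (Fin.succ 0))) = Fin.tail (Fin.tail v) := by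
        funext j
        simp only [Fin.tail, Function.comp]
        rw [Equiv.swap_apply_of_ne_of_ne]
        · simp [Fin.ext_iff]
        · simp [Fin.ext_iff]
      rw [ht]
      have hc := ifd_contDiff hf n (Fin.tail (Fin.tail v))
      have hs := (hc.contDiffAt (x := x)).isSymmSndFDerivAt (by simp [minSmoothness_of_isRCLikeNormedField]; exact WithTop.coe_le_coe.2 le_top)
      have e0 : (v ∘ Equiv.swap (Fin.castSucc (0 : Fin (n+1))) (Fin.succ 0)) 0 = v 1 := by
        have : (0 : Fin (n+2)) = Fin.castSucc 0 := rfl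
        simp only [Function.comp]
        rw [this, Equiv.swap_apply_left]; rfl
      have e1 : (v ∘ Equiv.swap (Fin.castSucc (0 : Fin (n+1))) (Fin.succ 0)) 1 = v 0 := by
        have : (1 : Fin (n+2)) = Fin.succ 0 := rfl
        simp only [Function.comp]
        rw [this, Equiv.swap_apply_right]; rfl
      rw [e0, e1]
      exact hs _ _
    | succ i =>
      rw [ifd_succ hf, ifd_succ hf]
      have ht : Fin.tail (v ∘ Equiv.swap i.succ.castSucc i.succ.succ) =
          Fin.tail v ∘ Equiv.swap i.castSucc i.succ := by
        funext j
        simp only [Fin.tail, Function.comp, Equiv.swap_apply_def, Fin.ext_iff, Fin.val_succ, Fin.val_castSucc]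
        congr 1
        split_ifs <;> simp_all
      have h0 : (v ∘ Equiv.swap i.succ.castSucc i.succ.succ) 0 = v 0 := by
        simp only [Function.comp]
        rw [Equiv.swap_apply_of_ne_of_ne]
        · simp [Fin.ext_iff]
        · simp [Fin.ext_iff]
      rw [ht, h0]
      simp_rw [ih]

theorem ifd_perm {f : E → F} (hf : ContDiff ℝ (⊤ : ℕ∞) f) (n : ℕ) (σ : Equiv.Perm (Fin n)) (x : E)
    (v : Fin n → E) :
    iteratedFDeriv ℝ n f x (v ∘ σ) = iteratedFDeriv ℝ n f x v := by
  cases n with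
  | zero => congr 1; exact Subsingleton.elim _ _
  | succ n =>
    have hσ : σ ∈ Submonoid.closure (Set.range fun i : Fin n => Equiv.swap i.castSucc i.succ) := by
      rw [Equiv.Perm.mclosure_swap_castSucc_succ]; trivial
    induction hσ using Submonoid.closure_induction generalizing v with
    | mem σ h => obtain ⟨i, rfl⟩ := h; exact ifd_swap hf n i x v
    | one => rfl
    | mul σ τ _ _ h1 h2 =>
      rw [Equiv.Perm.coe_mul, ← Function.comp_assoc, h2, h1]

theorem ifd_cast {f : E → F} {n n' : ℕ} (h : n = n') (x : E) (v : Fin n' → E) :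
    iteratedFDeriv ℝ n f x (v ∘ Fin.cast h) = iteratedFDeriv ℝ n' f x v := by
  subst h; rfl

theorem mixed_eq {A : E × F → G} (hA : ContDiff ℝ (⊤ : ℕ∞) A) (j l : ℕ) (x : E) (ξ : F)
    (y : Fin j → E) (η : Fin l → F) :
    iteratedFDeriv ℝ j (fun x' => iteratedFDeriv ℝ l (fun ξ' => A (x', ξ')) ξ) x y η =
      iteratedFDeriv ℝ (j + l) A (x, ξ)
        (Fin.append (fun i => ((y i, 0) : E × F)) (fun i => ((0, η i) : E × F))) := by
  have h0 : ∀ x', iteratedFDeriv ℝ l (fun ξ' => A (x', ξ')) ξ =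
      (iteratedFDeriv ℝ l A (x', ξ)).compContinuousLinearMap
        (fun _ => ContinuousLinearMap.inr ℝ E F) := by
    intro x'
    have e : (fun ξ' => A (x', ξ')) = (fun z => A ((x', 0) + z)) ∘ ContinuousLinearMap.inr ℝ E F := by
      funext ξ'; simp
    rw [e, ContinuousLinearMap.iteratedFDeriv_comp_right (n := (⊤ : ℕ∞)) _ _ _
      (WithTop.coe_le_coe.2 le_top), iteratedFDeriv_comp_add_left]
    · simp
    · exact hA.comp (contDiff_const.add contDiff_id)
  have hG : ContDiff ℝ (⊤ : ℕ∞) (fun x' => iteratedFDeriv ℝ l (fun ξ' => A (x', ξ')) ξ) := by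
    simp_rw [h0]
    have h : ContDiff ℝ (⊤ : ℕ∞) (iteratedFDeriv ℝ l A) := hA.iteratedFDeriv_right (by exact_mod_cast le_top)
    exact (ContinuousMultilinearMap.compContinuousLinearMapL
      (fun _ : Fin l => ContinuousLinearMap.inr ℝ E F)).contDiff.comp
      (h.comp (contDiff_id.prodMk contDiff_const))
  induction j generalizing x with
  | zero =>
    rw [iteratedFDeriv_zero_apply, h0]
    have := ifd_cast (f := A) (Nat.zero_add l) (x, ξ) (fun i => ((0, η i) : E × F))
    simp only [ContinuousMultilinearMap.compContinuousLinearMap_apply,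
      ContinuousLinearMap.inr_apply]
    rw [← this]
    congr 1
    rw [Subsingleton.elim (fun i => ((y i, 0) : E × F)) Fin.elim0, Fin.elim0_append]
  | succ j ih =>
    rw [ifd_succ hG]
    have hd : DifferentiableAt ℝ (fun x' => iteratedFDeriv ℝ j
        (fun x' => iteratedFDeriv ℝ l (fun ξ' => A (x', ξ')) ξ) x' (Fin.tail y)) x :=
      ((ifd_contDiff hG j (Fin.tail y)).differentiable (by simp)).differentiableAt
    have h1 := (((ContinuousMultilinearMap.apply ℝ (fun _ : Fin l => F) G η).hasFDerivAt).comp x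
      hd.hasFDerivAt).fderiv
    have h2 := congrArg (fun L => L (y 0)) h1
    simp only [ContinuousLinearMap.comp_apply, ContinuousMultilinearMap.apply_apply] at h2
    rw [← h2]
    set w := Fin.append (fun i => ((Fin.tail y i, 0) : E × F)) (fun i => ((0, η i) : E × F)) with hw
    have h3 : (⇑(ContinuousMultilinearMap.apply ℝ (fun _ : Fin l => F) G η) ∘
        fun x' => iteratedFDeriv ℝ j
        (fun x' => iteratedFDeriv ℝ l (fun ξ' => A (x', ξ')) ξ) x' (Fin.tail y)) =
        fun x' => iteratedFDeriv ℝ (j + l) A (x', ξ) w := by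
      funext x'
      simp only [Function.comp, ContinuousMultilinearMap.apply_apply]
      exact ih x' (Fin.tail y)
    rw [h3]
    have h4 : (Fin.append (fun i => ((y i, 0) : E × F)) (fun i => ((0, η i) : E × F))) =
        (Fin.cons (y 0, 0) w : Fin (j + l + 1) → E × F) ∘ Fin.cast (Nat.succ_add j l) := by
      rw [hw, ← Fin.append_cons]
      congr 1
      funext i
      induction i using Fin.cases <;> simp [Fin.tail]
    rw [h4, ifd_cast (Nat.succ_add j l), ifd_succ hA, Fin.tail_cons, Fin.cons_zero]
    have hd2 : DifferentiableAt ℝ (fun p => iteratedFDeriv ℝ (j + l) A p w) (x, ξ) :=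
      ((ifd_contDiff hA (j + l) w).differentiable (by simp)).differentiableAt
    have hp : HasFDerivAt (fun x' : E => (x', ξ)) (ContinuousLinearMap.inl ℝ E F) x :=
      hasFDerivAt_prodMk_left x ξ
    have h5 := (HasFDerivAt.comp x (f := fun x' : E => (x', ξ)) hd2.hasFDerivAt hp).fderiv
    have h6 := congrArg (fun L => L (y 0)) h5
    simpa [Function.comp_def] using h6

/-- The rescaling map `(y, η) ↦ (y, t η)`. -/
noncomputable def scaleMap (E F : Type*) [NormedAddCommGroup E] [NormedSpace ℝ E]
    [NormedAddCommGroup F] [NormedSpace ℝ F] (t : ℝ) : E × F →L[ℝ] E × F :=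
  (ContinuousLinearMap.fst ℝ E F).prod (t • ContinuousLinearMap.snd ℝ E F)

theorem scaleMap_apply (t : ℝ) (p : E × F) : scaleMap E F t p = (p.1, t • p.2) := rfl

theorem ifd_scale {A : E × F → G} (hA : ContDiff ℝ (⊤ : ℕ∞) A) (t : ℝ) (n : ℕ) (p : E × F)
    (v : Fin n → E × F) :
    iteratedFDeriv ℝ n (A ∘ scaleMap E F t) p v =
      iteratedFDeriv ℝ n A (scaleMap E F t p) (fun i => scaleMap E F t (v i)) := by
  rw [ContinuousLinearMap.iteratedFDeriv_comp_right (n := (⊤ : ℕ∞)) _ hA _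
      (WithTop.coe_le_coe.2 le_top)]
  rfl

theorem mixed_le_full {A : E × F → G} (hA : ContDiff ℝ (⊤ : ℕ∞) A) {t : ℝ} (ht : 0 < t)
    (j l : ℕ) (x : E) (ξ : F) :
    ‖iteratedFDeriv ℝ j (fun x' => iteratedFDeriv ℝ l (fun ξ' => A (x', ξ')) ξ) x‖ ≤
      ‖iteratedFDeriv ℝ (j + l) (A ∘ scaleMap E F t) (x, t⁻¹ • ξ)‖ * (t⁻¹) ^ l := by
  set R := ‖iteratedFDeriv ℝ (j + l) (A ∘ scaleMap E F t) (x, t⁻¹ • ξ)‖ with hR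
  refine ContinuousMultilinearMap.opNorm_le_bound (by positivity) fun y => ?_
  refine ContinuousMultilinearMap.opNorm_le_bound (by positivity) fun η => ?_
  rw [mixed_eq hA]
  have e := ifd_scale hA t (j + l) (x, t⁻¹ • ξ)
    (Fin.append (fun i => ((y i, 0) : E × F)) (fun i => ((0, t⁻¹ • η i) : E × F)))
  have e1 : scaleMap E F t (x, t⁻¹ • ξ) = (x, ξ) := by
    simp [scaleMap_apply, smul_smul, ht.ne']
  have e2 : (fun i => scaleMap E F t (Fin.append (fun i => ((y i, 0) : E × F))
      (fun i => ((0, t⁻¹ • η i) : E × F)) i)) =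
      Fin.append (fun i => ((y i, 0) : E × F)) (fun i => ((0, η i) : E × F)) := by
    funext i
    induction i using Fin.addCases <;> simp [scaleMap_apply, smul_smul, ht.ne']
  rw [e1, e2] at e
  rw [← e]
  refine (ContinuousMultilinearMap.le_opNorm _ _).trans (le_of_eq ?_)
  rw [Fin.prod_univ_add]
  simp only [Fin.append_left, Fin.append_right, Prod.norm_mk, norm_zero, norm_smul, norm_inv,
    Real.norm_eq_abs, abs_of_pos ht]
  have h1 : ∀ i, max ‖y i‖ 0 = ‖y i‖ := fun i => max_eq_left (norm_nonneg _)
  have h2 : ∀ i, max 0 (t⁻¹ * ‖η i‖) = t⁻¹ * ‖η i‖ := fun i => max_eq_right (by positivity)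
  simp only [h1, h2, Finset.prod_mul_distrib, Finset.prod_const, Finset.card_univ, Fintype.card_fin]
  ring

theorem full_le_mixed {A : E × F → G} (hA : ContDiff ℝ (⊤ : ℕ∞) A) {t : ℝ} (ht : 0 < t)
    (n : ℕ) (x : E) (ξ : F) (R : ℝ)
    (h : ∀ j l, j + l = n → t ^ l *
      ‖iteratedFDeriv ℝ j (fun x' => iteratedFDeriv ℝ l (fun ξ' => A (x', ξ')) ξ) x‖ ≤ R) :
    ‖iteratedFDeriv ℝ n (A ∘ scaleMap E F t) (x, t⁻¹ • ξ)‖ ≤ 2 ^ n * R := by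
  have hR : 0 ≤ R := le_trans (by positivity) (h 0 n (by simp))
  refine ContinuousMultilinearMap.opNorm_le_bound (by positivity) fun v => ?_
  have e1 : scaleMap E F t (x, t⁻¹ • ξ) = (x, ξ) := by
    simp [scaleMap_apply, smul_smul, ht.ne']
  rw [ifd_scale hA, e1]
  have e2 : (fun i => scaleMap E F t (v i)) =
      (fun i => (((v i).1, 0) : E × F)) + (fun i => ((0, t • (v i).2) : E × F)) := by
    funext i; simp [scaleMap_apply]
  rw [e2, ContinuousMultilinearMap.map_add_univ]
  have key : ∀ s : Finset (Fin n), ‖iteratedFDeriv ℝ n A (x, ξ)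
      (s.piecewise (fun i => (((v i).1, 0) : E × F)) (fun i => ((0, t • (v i).2) : E × F)))‖ ≤
      R * ∏ i, ‖v i‖ := by
    intro s
    obtain ⟨j, hj⟩ : ∃ j, s.card = j := ⟨_, rfl⟩
    obtain ⟨l, hl⟩ : ∃ l, sᶜ.card = l := ⟨_, rfl⟩
    have hn : j + l = n := by
      rw [← hj, ← hl, Finset.card_add_card_compl, Fintype.card_fin]
    let τ : Fin j ⊕ Fin l ≃ Fin n := finSumEquivOfFinset hj hl
    have hτl : ∀ i, τ (Sum.inl i) ∈ s := fun i => Finset.orderEmbOfFin_mem s hj i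
    have hτr : ∀ i, τ (Sum.inr i) ∉ s := fun i =>
      Finset.mem_compl.1 (Finset.orderEmbOfFin_mem sᶜ hl i)
    have hprod : ∏ i, ‖v i‖ = (∏ i, ‖v (τ (Sum.inl i))‖) * ∏ i, ‖v (τ (Sum.inr i))‖ := by
      rw [← Equiv.prod_comp τ, Fintype.prod_sum_type]
    rw [hprod]
    clear_value τ
    clear hprod hj hl
    subst hn
    rw [← ifd_perm hA (j + l) (finSumFinEquiv.symm.trans τ)]
    have e3 : (s.piecewise (fun i => (((v i).1, 0) : E × F))
        (fun i => ((0, t • (v i).2) : E × F))) ∘ (finSumFinEquiv.symm.trans τ) =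
        Fin.append (fun i => (((v (τ (Sum.inl i))).1, 0) : E × F))
          (fun i => ((0, t • (v (τ (Sum.inr i))).2) : E × F)) := by
      funext i
      induction i using Fin.addCases with
      | left i => simp [Finset.piecewise, hτl]
      | right i => simp [Finset.piecewise, hτr]
    rw [e3, ← mixed_eq hA]
    set M := iteratedFDeriv ℝ j (fun x' => iteratedFDeriv ℝ l (fun ξ' => A (x', ξ')) ξ) x with hM
    calc _ ≤ ‖M fun i => (v (τ (Sum.inl i))).1‖ * ∏ i, ‖t • (v (τ (Sum.inr i))).2‖ :=
          ContinuousMultilinearMap.le_opNorm _ _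
      _ ≤ (‖M‖ * ∏ i, ‖(v (τ (Sum.inl i))).1‖) * ∏ i, ‖t • (v (τ (Sum.inr i))).2‖ := by
          gcongr
          exact ContinuousMultilinearMap.le_opNorm _ _
      _ = (t ^ l * ‖M‖) * ((∏ i, ‖(v (τ (Sum.inl i))).1‖) * ∏ i, ‖(v (τ (Sum.inr i))).2‖) := by
          simp only [norm_smul, Finset.prod_mul_distrib, Finset.prod_const, Finset.card_univ,
            Fintype.card_fin, Real.norm_eq_abs, abs_of_pos ht]
          ring
      _ ≤ _ := by
          gcongr
          · exact h j l rfl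
          · exact norm_fst_le _
          · exact norm_snd_le _
  refine (norm_sum_le_of_le _ (fun s _ => key s)).trans (le_of_eq ?_)
  simp [mul_assoc]

end

theorem one_le_jap {N : ℕ} (ξ : EuclideanSpace ℝ (Fin N)) : 1 ≤ jap ξ := by
  unfold jap
  apply Real.one_le_rpow <;> [nlinarith [sq_nonneg ‖ξ‖]; norm_num]

theorem jw_bounds (r : ℝ) (hr : 0 ≤ r) : 1 ≤ (1 + r ^ 2) ^ ((1 : ℝ) / 2) ∧
    r ≤ (1 + r ^ 2) ^ ((1 : ℝ) / 2) ∧ (1 + r ^ 2) ^ ((1 : ℝ) / 2) ≤ 1 + r := by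
  rw [← Real.sqrt_eq_rpow]
  refine ⟨?_, ?_, ?_⟩
  · rw [Real.one_le_sqrt]; nlinarith
  · apply Real.le_sqrt_of_sq_le; linarith
  · rw [Real.sqrt_le_left (by linarith)]; nlinarith

theorem rpow_between {c C r : ℝ} (hc : 0 < c) (h1 : c ≤ r) (h2 : r ≤ C) (e : ℝ) :
    r ^ e ≤ c ^ e + C ^ e := by
  have hr : 0 < r := hc.trans_le h1
  have hC : 0 < C := hr.trans_le h2
  have := Real.rpow_pos_of_pos hc e
  have := Real.rpow_pos_of_pos hC e
  rcases le_total 0 e with he | he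
  · have := Real.rpow_le_rpow hr.le h2 he
    linarith
  · have := Real.rpow_le_rpow_of_nonpos hc h1 he
    linarith

/-- If `f` is a symbol of order `k` on `ℂ` and `a` is a `μ`-elliptic symbol of type
`(1,0)` and order `m ≥ 0`, then `f ∘ a` is a symbol of type `(1,0)` and order `m·k`. -/
theorem statement0 (d N : ℕ) (hd : 0 < d) (hN : 0 < N) (m k μ : ℝ) (hm : 0 ≤ m)
    (hμ : 0 < μ) (f : ℂ → ℂ) (hf : IsSymbolOnC k f)
    (a : EuclideanSpace ℝ (Fin d) → EuclideanSpace ℝ (Fin N) → ℂ)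
    (ha : IsSymbol d N m a)
    (hell : ∀ x ξ, μ ≤ ‖ξ‖ → μ⁻¹ * jap ξ ^ m ≤ ‖a x ξ‖) :
    IsSymbol d N (m * k) (fun x ξ => f (a x ξ)) := by
  obtain ⟨hfs, hfb⟩ := hf
  obtain ⟨has, hab⟩ := ha
  refine ⟨hfs.comp has, fun j l => ?_⟩
  choose Cf hCf using hfb
  choose Ca hCa using hab
  -- two-sided bound for `⟨a⟩`
  obtain ⟨c, C, hc, hcC⟩ : ∃ c C : ℝ, 0 < c ∧ ∀ x ξ,
      c * jap ξ ^ m ≤ (1 + ‖a x ξ‖ ^ 2) ^ ((1 : ℝ) / 2) ∧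
      (1 + ‖a x ξ‖ ^ 2) ^ ((1 : ℝ) / 2) ≤ C * jap ξ ^ m := by
    set b := ((1 + μ ^ 2) ^ ((1 : ℝ) / 2)) ^ m with hb
    have hbpos : 0 < b := by positivity
    refine ⟨min μ⁻¹ b⁻¹, 1 + Ca 0 0, by positivity, fun x ξ => ?_⟩
    obtain ⟨h1, h2, h3⟩ := jw_bounds ‖a x ξ‖ (norm_nonneg _)
    have hs : 1 ≤ jap ξ ^ m := Real.one_le_rpow (one_le_jap ξ) hm
    have hs0 : 0 ≤ jap ξ ^ m := by linarith
    constructor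
    · rcases le_total μ ‖ξ‖ with h | h
      · exact (mul_le_mul_of_nonneg_right (min_le_left _ _) hs0).trans ((hell x ξ h).trans h2)
      · refine (mul_le_mul_of_nonneg_right (min_le_right _ _) hs0).trans (le_trans ?_ h1)
        rw [inv_mul_le_iff₀ hbpos, mul_one, hb]
        unfold jap
        gcongr
    · have h0 := hCa 0 0 x ξ
      simp only [norm_iteratedFDeriv_zero, CharP.cast_eq_zero, sub_zero] at h0
      linarith
  set n := j + l with hn
  -- bound for scaled derivatives of f
  let Kf : ℕ → ℝ := fun i => |Cf i| * (c ^ (k - i) + C ^ (k - i))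
  let K1 : ℝ := ∑ i ∈ Finset.range (n + 1), |Kf i|
  let K2 : ℝ := 1 + ∑ i ∈ Finset.range (n + 1), 2 ^ i * ∑ q ∈ Finset.HasAntidiagonal.antidiagonal i, |Ca q.1 q.2|
  have hK2 : 1 ≤ K2 := le_add_of_nonneg_right (by positivity)
  refine ⟨n.factorial * K1 * K2 ^ n, fun x ξ => ?_⟩
  set t := jap ξ with ht
  have ht1 : 1 ≤ t := one_le_jap ξ
  have ht0 : 0 < t := by linarith
  set s := t ^ m with hs
  have hs0 : 0 < s := Real.rpow_pos_of_pos ht0 m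
  let A : EuclideanSpace ℝ (Fin d) × EuclideanSpace ℝ (Fin N) → ℂ := fun p => a p.1 p.2
  let T := scaleMap (EuclideanSpace ℝ (Fin d)) (EuclideanSpace ℝ (Fin N)) t
  let p : EuclideanSpace ℝ (Fin d) × EuclideanSpace ℝ (Fin N) := (x, t⁻¹ • ξ)
  have hTp : T p = (x, ξ) := by simp [T, p, scaleMap_apply, smul_smul, ht0.ne']
  let g : EuclideanSpace ℝ (Fin d) × EuclideanSpace ℝ (Fin N) → ℂ := fun q => s⁻¹ • (A ∘ T) q
  let φ : ℂ → ℂ := fun w => f (s • w)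
  have hAT : ContDiff ℝ (⊤ : ℕ∞) (A ∘ T) := has.comp T.contDiff
  have hg : ContDiff ℝ (⊤ : ℕ∞) g := hAT.const_smul s⁻¹
  have hφ : ContDiff ℝ (⊤ : ℕ∞) φ := hfs.comp (contDiff_const_smul s)
  have hsg : s • g p = a x ξ := by
    simp only [g, Function.comp, hTp, A, smul_smul, mul_inv_cancel₀ hs0.ne', one_smul]
  have hcomp : φ ∘ g = (fun q => f (A q)) ∘ T := by
    funext q
    simp only [φ, g, Function.comp, smul_smul, mul_inv_cancel₀ hs0.ne', one_smul]
  have b1 : ∀ i ≤ n, ‖iteratedFDeriv ℝ i φ (g p)‖ ≤ K1 * s ^ k := by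
    intro i hi
    have e := congrFun (iteratedFDeriv_comp_const_smul (i := i) s
      (hfs.of_le (by exact_mod_cast le_top))) (g p)
    simp only [φ]
    rw [e, hsg, norm_smul, norm_pow, Real.norm_eq_abs, abs_of_pos hs0]
    obtain ⟨h1, h2⟩ := hcC x ξ
    have hw := hCf i (a x ξ)
    set w := (1 + ‖a x ξ‖ ^ 2) ^ ((1 : ℝ) / 2) with hwdef
    have hw0 : 0 < w := by positivity
    have h3 : (w / s) ^ (k - i) ≤ c ^ (k - i) + C ^ (k - i) :=
      rpow_between hc (by rwa [le_div_iff₀ hs0]) (by rwa [div_le_iff₀ hs0]) _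
    have h4 : w ^ (k - i) = (w / s) ^ (k - i) * s ^ (k - i) := by
      rw [← Real.mul_rpow (by positivity) hs0.le, div_mul_cancel₀ _ hs0.ne']
    have h5 : s ^ i * s ^ (k - i) = s ^ k := by
      rw [← Real.rpow_natCast, ← Real.rpow_add hs0]; congr 1; ring
    calc s ^ i * ‖iteratedFDeriv ℝ i f (a x ξ)‖ ≤ s ^ i * (|Cf i| * w ^ (k - i)) := by
          gcongr
          exact hw.trans (by gcongr; exact le_abs_self _)
      _ = |Cf i| * (w / s) ^ (k - i) * s ^ k := by rw [h4, ← h5]; ring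
      _ ≤ Kf i * s ^ k := by
          simp only [Kf]; gcongr
      _ ≤ K1 * s ^ k := by
          gcongr
          refine (le_abs_self _).trans ?_
          exact Finset.single_le_sum (f := fun i => |Kf i|) (fun _ _ => abs_nonneg _)
            (Finset.mem_range.2 (by omega))
  have b2 : ∀ i, 1 ≤ i → i ≤ n → ‖iteratedFDeriv ℝ i g p‖ ≤ K2 ^ i := by
    intro i hi1 hi
    have e : iteratedFDeriv ℝ i g p = s⁻¹ • iteratedFDeriv ℝ i (A ∘ T) p :=
      iteratedFDeriv_const_smul_apply' ((hAT.of_le (by exact_mod_cast le_top)).contDiffAt)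
    have hfull := full_le_mixed (A := A) has ht0 i x ξ
      ((∑ q ∈ Finset.HasAntidiagonal.antidiagonal i, |Ca q.1 q.2|) * s) (by
        intro j' l' hjl
        have hb := hCa j' l' x ξ
        have h5 : t ^ l' * t ^ (m - l') = s := by
          rw [← Real.rpow_natCast, ← Real.rpow_add ht0]; congr 1; ring
        calc _ ≤ t ^ l' * (|Ca j' l'| * t ^ (m - l')) := by
              gcongr
              exact hb.trans (by gcongr; exact le_abs_self _)
          _ = |Ca j' l'| * s := by rw [← h5]; ring
          _ ≤ _ := by
              gcongr
              exact Finset.single_le_sum (f := fun q : ℕ × ℕ => |Ca q.1 q.2|)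
                (fun _ _ => abs_nonneg _) (a := (j', l')) (by simpa using hjl))
    rw [e, norm_smul, norm_inv, Real.norm_eq_abs, abs_of_pos hs0]
    calc _ ≤ s⁻¹ * (2 ^ i * ((∑ q ∈ Finset.HasAntidiagonal.antidiagonal i, |Ca q.1 q.2|) * s)) := by
          gcongr
      _ = 2 ^ i * ∑ q ∈ Finset.HasAntidiagonal.antidiagonal i, |Ca q.1 q.2| := by field_simp
      _ ≤ ∑ i ∈ Finset.range (n + 1), 2 ^ i * ∑ q ∈ Finset.HasAntidiagonal.antidiagonal i, |Ca q.1 q.2| :=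
          Finset.single_le_sum
            (f := fun i => (2 : ℝ) ^ i * ∑ q ∈ Finset.HasAntidiagonal.antidiagonal i, |Ca q.1 q.2|)
            (fun _ _ => by positivity) (Finset.mem_range.2 (by omega))
      _ ≤ K2 := by simp only [K2]; linarith
      _ ≤ K2 ^ i := le_self_pow₀ hK2 (by omega)
  have main := norm_iteratedFDeriv_comp_le hφ hg (n := n) (by exact_mod_cast le_top) p b1 b2
  rw [hcomp] at main
  have hmix := mixed_le_full (A := fun q => f (A q)) (hfs.comp has) ht0 j l x ξ
  have h6 : s ^ k * (t⁻¹) ^ l = t ^ (m * k - l) := by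
    rw [Real.rpow_sub ht0, Real.rpow_mul ht0.le, Real.rpow_natCast, inv_pow, div_eq_mul_inv]
  calc _ ≤ _ := hmix
    _ ≤ (n.factorial * (K1 * s ^ k) * K2 ^ n) * (t⁻¹) ^ l := by
        gcongr
    _ = _ := by rw [← h6]; ring
end

section
/- Let d, N be positive integers, m ≥ 0, k ∈ ℝ, μ > 0, and ε > 0. Let f : [ε,∞) → ℂ be smooth with the property that for every j ∈ ℕ there is C(j) with |f^{(j)}(x)| ≤ C(j)·x^{k−j} for all x ≥ ε. Let a : ℝ^d × ℝ^N → ℝ be a real-valued symbol of type (1,0) and order m satisfying a(x,ξ) ≥ ε for all (x,ξ), and which is μ-elliptic (i.e. a(x,ξ) ≥ μ^{-1}·⟨ξ⟩^m whenever ‖ξ‖ ≥ μ). Then f ∘ a is a symbol of type (1,0) and order m·k. -/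
set_option linter.unusedSectionVars false

section DirDeriv

variable {E G V : Type*} [NormedAddCommGroup E] [NormedSpace ℝ E] [NormedAddCommGroup G]
  [NormedSpace ℝ G] [NormedAddCommGroup V] [NormedSpace ℝ V]

/-- iterated directional derivative along a list of vectors -/
noncomputable def dirD : List E → (E → V) → E → V
  | [], F => F
  | u :: us, F => fun p => fderiv ℝ (dirD us F) p u

theorem dirD_append (us vs : List E) (F : E → V) :
    dirD (us ++ vs) F = dirD us (dirD vs F) := by
  induction us with
  | nil => rfl
  | cons u us ih => simp only [List.cons_append, dirD, ih]

theorem dirD_contDiff {F : E → V} (hF : ContDiff ℝ (⊤ : ℕ∞) F) (us : List E) :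
    ContDiff ℝ (⊤ : ℕ∞) (dirD us F) := by
  induction us with
  | nil => exact hF
  | cons u us ih =>
    have : ContDiff ℝ (⊤ : ℕ∞) (fderiv ℝ (dirD us F)) := ih.fderiv_right (by simp)
    exact this.clm_apply contDiff_const

theorem dirD_differentiable {F : E → V} (hF : ContDiff ℝ (⊤ : ℕ∞) F) (us : List E) :
    Differentiable ℝ (dirD us F) := (dirD_contDiff hF us).differentiable (by simp)

theorem dirD_perm {F : E → V} (hF : ContDiff ℝ (⊤ : ℕ∞) F) {us vs : List E}
    (h : us.Perm vs) : dirD us F = dirD vs F := by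
  induction h with
  | nil => rfl
  | cons x _ ih => simp only [dirD, ih]
  | swap x y l =>
    have h2 : ContDiff ℝ (⊤ : ℕ∞) (dirD l F) := dirD_contDiff hF l
    have h1 : ContDiff ℝ (⊤ : ℕ∞) (fderiv ℝ (dirD l F)) := h2.fderiv_right (by simp)
    have h1' : Differentiable ℝ (fderiv ℝ (dirD l F)) := h1.differentiable (by simp)
    funext p
    have hs : IsSymmSndFDerivAt ℝ (dirD l F) p := by
      apply h2.contDiffAt.isSymmSndFDerivAt
      simp
      exact WithTop.coe_le_coe.2 (le_top : (2 : ℕ∞) ≤ ⊤)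
    simp only [dirD]
    have key : ∀ a b : E, fderiv ℝ (fun q => fderiv ℝ (dirD l F) q a) p b
        = fderiv ℝ (fderiv ℝ (dirD l F)) p b a := by
      intro a b
      rw [fderiv_clm_apply (h1' p) (differentiableAt_const a)]
      simp
    rw [key, key]
    exact hs _ _
  | trans _ _ ih1 ih2 => rw [ih1, ih2]

theorem iteratedFDeriv_eq_dirD {F : E → V} (hF : ContDiff ℝ (⊤ : ℕ∞) F) (n : ℕ)
    (v : Fin n → E) (p : E) : iteratedFDeriv ℝ n F p v = dirD (List.ofFn v) F p := by
  induction n generalizing p with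
  | zero => simp [dirD]
  | succ n ih =>
    have hd : Differentiable ℝ (iteratedFDeriv ℝ n F) :=
      hF.differentiable_iteratedFDeriv (by exact_mod_cast WithTop.coe_lt_top n)
    rw [iteratedFDeriv_succ_apply_left, List.ofFn_succ]
    simp only [dirD]
    have : (dirD (List.ofFn fun i : Fin n => v i.succ) F)
        = fun q => iteratedFDeriv ℝ n F q (Fin.tail v) := by
      funext q
      rw [ih]; rfl
    rw [this, fderiv_continuousMultilinear_apply_const_apply (hd p)]

theorem dirD_comp_of_fderiv {F : E → V} (hF : ContDiff ℝ (⊤ : ℕ∞) F) (L : G → E)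
    (L' : G →L[ℝ] E) (hL : ∀ x, HasFDerivAt L L' x) (us : List G) :
    dirD us (fun x => F (L x)) = fun x => dirD (us.map L') F (L x) := by
  induction us with
  | nil => rfl
  | cons u us ih =>
    funext x
    simp only [dirD, List.map_cons, ih]
    have := ((dirD_differentiable hF (us.map L')) (L x)).hasFDerivAt.comp x (hL x)
    have h2 := this.fderiv
    simp only [Function.comp_def] at h2
    rw [h2]; rfl

theorem mixed_eq_dirD {a : E → G → V}
    (ha : ContDiff ℝ (⊤ : ℕ∞) (fun p : E × G => a p.1 p.2)) (j l : ℕ) (x : E) (ξ : G)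
    (v : Fin j → E) (w : Fin l → G) :
    iteratedFDeriv ℝ j (fun x' => iteratedFDeriv ℝ l (fun ξ' => a x' ξ') ξ) x v w
      = dirD ((List.ofFn v).map (ContinuousLinearMap.inl ℝ E G)
          ++ (List.ofFn w).map (ContinuousLinearMap.inr ℝ E G))
          (fun p : E × G => a p.1 p.2) (x, ξ) := by
  set F := fun p : E × G => a p.1 p.2 with hF
  have hr : ∀ (x' : E) (η : G), HasFDerivAt (fun ξ' : G => (x', ξ'))
      (ContinuousLinearMap.inr ℝ E G) η := fun x' η => hasFDerivAt_prodMk_right x' η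
  have hl : ∀ (η : G) (x' : E), HasFDerivAt (fun x' : E => (x', η))
      (ContinuousLinearMap.inl ℝ E G) x' := fun η x' => hasFDerivAt_prodMk_left x' η
  have hax : ∀ x', ContDiff ℝ (⊤ : ℕ∞) (fun ξ' => a x' ξ') := fun x' =>
    ha.comp (contDiff_const.prodMk contDiff_id)
  have h1 : ∀ x' (w : Fin l → G), iteratedFDeriv ℝ l (fun ξ' => a x' ξ') ξ w
      = dirD ((List.ofFn w).map (ContinuousLinearMap.inr ℝ E G)) F (x', ξ) := by
    intro x' w
    rw [iteratedFDeriv_eq_dirD (hax x')]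
    exact congrFun (dirD_comp_of_fderiv ha (fun ξ' => (x', ξ')) _ (hr x') (List.ofFn w)) ξ
  have h2 : (fun x' => iteratedFDeriv ℝ l (fun ξ' => a x' ξ') ξ)
      = fun x' => ContinuousMultilinearMap.compContinuousLinearMapL
        (fun _ => ContinuousLinearMap.inr ℝ E G) (iteratedFDeriv ℝ l F (x', ξ)) := by
    funext x'
    ext w
    rw [h1, ContinuousMultilinearMap.compContinuousLinearMapL_apply,
      ContinuousMultilinearMap.compContinuousLinearMap_apply, iteratedFDeriv_eq_dirD ha,
      List.map_ofFn]
    rfl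
  have h3 : ContDiff ℝ (⊤ : ℕ∞) (fun x' => iteratedFDeriv ℝ l (fun ξ' => a x' ξ') ξ) := by
    rw [h2]
    apply ContinuousLinearMap.contDiff _ |>.comp
    have : ContDiff ℝ (⊤ : ℕ∞) (iteratedFDeriv ℝ l F) := ha.iteratedFDeriv_right (by exact_mod_cast le_top)
    exact this.comp (contDiff_id.prodMk contDiff_const)
  have h4 := (ContinuousMultilinearMap.apply ℝ (fun _ : Fin l => G) V w).iteratedFDeriv_comp_left
    (h3.contDiffAt (x := x)) (i := j) (by exact_mod_cast le_top)
  have h5 := congrArg (fun q => q v) h4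
  simp only [ContinuousLinearMap.compContinuousMultilinearMap_coe, Function.comp_apply,
    ContinuousMultilinearMap.apply_apply] at h5
  rw [← h5, dirD_append]
  have h6 : (⇑(ContinuousMultilinearMap.apply ℝ (fun _ : Fin l => G) V w) ∘
      fun x' => iteratedFDeriv ℝ l (fun ξ' => a x' ξ') ξ) =
      fun x' => dirD ((List.ofFn w).map (ContinuousLinearMap.inr ℝ E G)) F (x', ξ) := by
    funext x'
    simp only [Function.comp_apply, ContinuousMultilinearMap.apply_apply, h1]
  rw [h6, iteratedFDeriv_eq_dirD]
  · exact congrFun (dirD_comp_of_fderiv (dirD_contDiff ha _) (fun x' => (x', ξ)) _ (hl ξ) _) x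
  · exact (dirD_contDiff ha _).comp (contDiff_id.prodMk contDiff_const)

/-- product of the norms of a list -/
noncomputable def nprod (us : List E) : ℝ := (us.map norm).prod

theorem nprod_nonneg (us : List E) : 0 ≤ nprod us := by
  apply List.prod_nonneg
  intro r hr
  obtain ⟨u, -, rfl⟩ := List.mem_map.1 hr
  exact norm_nonneg u

theorem nprod_cons (u : E) (us : List E) : nprod (u :: us) = ‖u‖ * nprod us := by
  simp [nprod]

theorem nprod_ofFn {n : ℕ} (v : Fin n → E) : nprod (List.ofFn v) = ∏ i, ‖v i‖ := by
  simp [nprod, List.map_ofFn, List.prod_ofFn]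

theorem dirD_full_bound {F : E × G → V} (hF : ContDiff ℝ (⊤ : ℕ∞) F) (p : E × G) (n : ℕ)
    (M : ℝ) (hM : 0 ≤ M)
    (H : ∀ (xs : List E) (ws : List G), xs.length + ws.length = n →
      ‖dirD (xs.map (ContinuousLinearMap.inl ℝ E G) ++ ws.map (ContinuousLinearMap.inr ℝ E G)) F p‖
        ≤ M * nprod xs * nprod ws) (us : List (E × G)) :
    ∀ (xs : List E) (ws : List G), us.length + xs.length + ws.length = n →
      ‖dirD (us ++ (xs.map (ContinuousLinearMap.inl ℝ E G)
          ++ ws.map (ContinuousLinearMap.inr ℝ E G))) F p‖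
        ≤ 2 ^ us.length * M * nprod us * nprod xs * nprod ws := by
  induction us with
  | nil =>
    intro xs ws h
    simpa [nprod] using H xs ws (by simpa using h)
  | cons u us ih =>
    intro xs ws h
    set rest := xs.map (ContinuousLinearMap.inl ℝ E G) ++ ws.map (ContinuousLinearMap.inr ℝ E G)
      with hrest
    have hu : u = ContinuousLinearMap.inl ℝ E G u.1 + ContinuousLinearMap.inr ℝ E G u.2 := by
      simp
    have hsplit : dirD ((u :: us) ++ rest) F p
        = dirD ((ContinuousLinearMap.inl ℝ E G u.1 :: us) ++ rest) F p
          + dirD ((ContinuousLinearMap.inr ℝ E G u.2 :: us) ++ rest) F p := by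
      simp only [List.cons_append, dirD]
      rw [← map_add, ← hu]
    have p1 : ((ContinuousLinearMap.inl ℝ E G u.1 :: us) ++ rest).Perm
        (us ++ ((u.1 :: xs).map (ContinuousLinearMap.inl ℝ E G)
          ++ ws.map (ContinuousLinearMap.inr ℝ E G))) := by
      simp only [List.map_cons, List.cons_append]
      exact List.perm_middle.symm
    have p2 : ((ContinuousLinearMap.inr ℝ E G u.2 :: us) ++ rest).Perm
        (us ++ (xs.map (ContinuousLinearMap.inl ℝ E G)
          ++ (u.2 :: ws).map (ContinuousLinearMap.inr ℝ E G))) := by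
      simp only [List.map_cons, List.cons_append]
      rw [hrest]
      refine List.Perm.trans ?_ (List.Perm.append_left us List.perm_middle.symm)
      exact List.perm_middle.symm
    simp only [List.length_cons] at h
    have b1 := ih (u.1 :: xs) ws (by simp only [List.length_cons]; omega)
    have b2 := ih xs (u.2 :: ws) (by simp only [List.length_cons]; omega)
    rw [hsplit, dirD_perm hF p1, dirD_perm hF p2]
    refine (norm_add_le _ _).trans ((add_le_add b1 b2).trans ?_)
    simp only [nprod_cons, List.length_cons]
    have n0 := nprod_nonneg us
    have n1 := nprod_nonneg xs
    have n2 := nprod_nonneg ws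
    have e1 : ‖u.1‖ ≤ ‖u‖ := norm_fst_le u
    have e2 : ‖u.2‖ ≤ ‖u‖ := norm_snd_le u
    have : 0 ≤ 2 ^ us.length * M * nprod us * nprod xs * nprod ws := by positivity
    calc _ = (2 ^ us.length * M * nprod us * nprod xs * nprod ws) * (‖u.1‖ + ‖u.2‖) := by ring
      _ ≤ (2 ^ us.length * M * nprod us * nprod xs * nprod ws) * (‖u‖ + ‖u‖) := by gcongr
      _ = _ := by ring


theorem norm_dirD_le {F : E → V} (hF : ContDiff ℝ (⊤ : ℕ∞) F) (us : List E) (p : E) :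
    ‖dirD us F p‖ ≤ ‖iteratedFDeriv ℝ us.length F p‖ * nprod us := by
  have h := iteratedFDeriv_eq_dirD hF us.length us.get p
  have h2 := nprod_ofFn us.get
  rw [List.ofFn_get] at h h2
  rw [← h, h2]
  exact ContinuousMultilinearMap.le_opNorm _ _

theorem nprod_map_smul (R : ℝ) (hR : 0 ≤ R) (ws : List G) :
    nprod (ws.map (fun w => R • w)) = R ^ ws.length * nprod ws := by
  induction ws with
  | nil => simp [nprod]
  | cons w ws ih =>
    simp only [List.map_cons, nprod_cons, ih, norm_smul, Real.norm_of_nonneg hR, List.length_cons]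
    ring

theorem nprod_map_inl (xs : List E) :
    nprod (xs.map (ContinuousLinearMap.inl ℝ E G)) = nprod xs := by
  simp [nprod, Function.comp_def]

theorem nprod_map_inr (xs : List G) :
    nprod (xs.map (ContinuousLinearMap.inr ℝ E G)) = nprod xs := by
  simp [nprod, Function.comp_def]

theorem nprod_append (xs ys : List E) : nprod (xs ++ ys) = nprod xs * nprod ys := by
  simp [nprod]

/-- rescaling in the second variable -/
noncomputable def scl (R : ℝ) : E × G →L[ℝ] E × G :=
  (ContinuousLinearMap.fst ℝ E G).prod (R • ContinuousLinearMap.snd ℝ E G)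

theorem dirD_scl {F : E × G → V} (hF : ContDiff ℝ (⊤ : ℕ∞) F) (R : ℝ) (xs : List E)
    (ws : List G) (p : E × G) :
    dirD (xs.map (ContinuousLinearMap.inl ℝ E G) ++ ws.map (ContinuousLinearMap.inr ℝ E G))
      (fun q => F (scl R q)) p =
    dirD (xs.map (ContinuousLinearMap.inl ℝ E G) ++
      (ws.map (fun w => R • w)).map (ContinuousLinearMap.inr ℝ E G)) F (scl R p) := by
  rw [dirD_comp_of_fderiv hF (scl R) (scl R) (fun x => (scl R : E × G →L[ℝ] E × G).hasFDerivAt)]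
  have : (xs.map (ContinuousLinearMap.inl ℝ E G) ++
      ws.map (ContinuousLinearMap.inr ℝ E G)).map (scl R) =
      (xs.map (ContinuousLinearMap.inl ℝ E G) ++
      (ws.map (fun w => R • w)).map (ContinuousLinearMap.inr ℝ E G)) := by
    simp [List.map_append, scl, Function.comp_def]
  rw [this]

theorem scale_in {a : E → G → V}
    (ha : ContDiff ℝ (⊤ : ℕ∞) (fun p : E × G => a p.1 p.2)) (R : ℝ) (hR : 0 < R) (n : ℕ)
    (M : ℝ) (hM : 0 ≤ M) (x : E) (ξ : G)
    (H : ∀ j l, j + l = n →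
      ‖iteratedFDeriv ℝ j (fun x' => iteratedFDeriv ℝ l (fun ξ' => a x' ξ') ξ) x‖ * R ^ l ≤ M) :
    ‖iteratedFDeriv ℝ n (fun q : E × G => a (scl R q).1 (scl R q).2) (x, R⁻¹ • ξ)‖
      ≤ 2 ^ n * M := by
  have hF : ContDiff ℝ (⊤ : ℕ∞) (fun q : E × G => a (scl R q).1 (scl R q).2) :=
    ha.comp (scl R : E × G →L[ℝ] E × G).contDiff
  have hpt : (scl R : E × G →L[ℝ] E × G) (x, R⁻¹ • ξ) = (x, ξ) := by
    simp [scl, smul_smul, hR.ne']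
  apply ContinuousMultilinearMap.opNorm_le_bound (by positivity)
  intro u
  rw [iteratedFDeriv_eq_dirD hF]
  have := dirD_full_bound hF (x, R⁻¹ • ξ) n M hM ?_ (List.ofFn u) [] [] (by simp)
  · rw [nprod_ofFn] at this
    simpa [nprod] using this
  · intro xs ws hl
    have hs := dirD_scl ha R xs ws (x, R⁻¹ • ξ)
    rw [hs, hpt]
    have hm := mixed_eq_dirD ha xs.length ws.length x ξ xs.get (fun i => R • ws.get i)
    have hw : List.ofFn (fun i => R • ws.get i) = ws.map (fun w => R • w) := by
      conv_rhs => rw [← List.ofFn_get ws, List.map_ofFn]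
      rfl
    rw [List.ofFn_get, hw] at hm
    rw [← hm]
    have hp1 := nprod_ofFn xs.get
    have hp2 := nprod_ofFn (fun i => R • ws.get i)
    rw [List.ofFn_get] at hp1
    rw [hw, nprod_map_smul R hR.le] at hp2
    refine (ContinuousMultilinearMap.le_opNorm _ _).trans ?_
    rw [← hp2]
    have h1 := ContinuousMultilinearMap.le_opNorm (iteratedFDeriv ℝ xs.length
      (fun x' => iteratedFDeriv ℝ ws.length (fun ξ' => a x' ξ') ξ) x) xs.get
    rw [← hp1] at h1
    have n1 := nprod_nonneg xs
    have n2 := nprod_nonneg ws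
    have h2 := H _ _ hl
    calc _ ≤ _ := mul_le_mul_of_nonneg_right h1 (by positivity)
      _ = (‖iteratedFDeriv ℝ xs.length (fun x' => iteratedFDeriv ℝ ws.length
            (fun ξ' => a x' ξ') ξ) x‖ * R ^ ws.length) * nprod xs * nprod ws := by ring
      _ ≤ _ := by gcongr

theorem scale_out {a : E → G → V}
    (ha : ContDiff ℝ (⊤ : ℕ∞) (fun p : E × G => a p.1 p.2)) (R : ℝ) (hR : 0 < R) (j l : ℕ)
    (B : ℝ) (hB : 0 ≤ B) (x : E) (ξ : G)
    (H : ‖iteratedFDeriv ℝ (j + l) (fun q : E × G => a (scl R q).1 (scl R q).2) (x, R⁻¹ • ξ)‖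
      ≤ B) :
    ‖iteratedFDeriv ℝ j (fun x' => iteratedFDeriv ℝ l (fun ξ' => a x' ξ') ξ) x‖
      ≤ B * R⁻¹ ^ l := by
  have hF : ContDiff ℝ (⊤ : ℕ∞) (fun q : E × G => a (scl R q).1 (scl R q).2) :=
    ha.comp (scl R : E × G →L[ℝ] E × G).contDiff
  have hpt : (scl R : E × G →L[ℝ] E × G) (x, R⁻¹ • ξ) = (x, ξ) := by
    simp [scl, smul_smul, hR.ne']
  have hR' : 0 < R⁻¹ := inv_pos.2 hR
  apply ContinuousMultilinearMap.opNorm_le_bound (by positivity)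
  intro v
  apply ContinuousMultilinearMap.opNorm_le_bound (by positivity)
  intro w
  rw [mixed_eq_dirD ha]
  have hs := dirD_scl ha R (List.ofFn v) ((List.ofFn w).map (fun w => R⁻¹ • w)) (x, R⁻¹ • ξ)
  have hid : ((List.ofFn w).map (fun w => R⁻¹ • w)).map (fun w => R • w) = List.ofFn w := by
    rw [List.map_map]
    convert List.map_id _ using 2
    funext w
    simp [smul_smul, hR.ne']
  rw [hid, hpt] at hs
  rw [← hs]
  refine (norm_dirD_le hF _ _).trans ?_
  rw [nprod_append, nprod_map_inl, nprod_map_inr, nprod_map_smul _ hR'.le]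
  have hlen : ∀ q : ℕ, q = j + l →
      ‖iteratedFDeriv ℝ q (fun q : E × G => a (scl R q).1 (scl R q).2) (x, R⁻¹ • ξ)‖ ≤ B := by
    rintro q rfl
    exact H
  have hlen' := hlen (List.map (⇑(ContinuousLinearMap.inl ℝ E G)) (List.ofFn v) ++
    List.map (⇑(ContinuousLinearMap.inr ℝ E G))
      (List.map (fun w => R⁻¹ • w) (List.ofFn w))).length (by simp)
  rw [nprod_ofFn, nprod_ofFn, List.length_ofFn]
  calc _ ≤ B * ((∏ i, ‖v i‖) * (R⁻¹ ^ l * ∏ i, ‖w i‖)) := by gcongr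
    _ = _ := by ring

theorem comp_bound (ε k : ℝ) (hε : 0 < ε) (f : ℝ → V)
    (hf : ContDiffOn ℝ (⊤ : ℕ∞) f (Set.Ici ε)) (n : ℕ) (S : ℝ) (hS : 0 < S)
    (Φ : E → ℝ) (hΦ : ContDiff ℝ (⊤ : ℕ∞) Φ) (hΦε : ∀ p, ε ≤ Φ p) (p : E) (K D : ℝ)
    (hK : ∀ i ≤ n, ‖iteratedDerivWithin i f (Set.Ici ε) (Φ p)‖ ≤ K * S ^ (k - i))
    (hD : ∀ i, 1 ≤ i → i ≤ n → ‖iteratedFDeriv ℝ i Φ p‖ ≤ D ^ i * S) :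
    ‖iteratedFDeriv ℝ n (fun q => f (Φ q)) p‖ ≤ n.factorial * (K * S ^ k) * D ^ n := by
  let L : ℝ →L[ℝ] ℝ := S • ContinuousLinearMap.id ℝ ℝ
  have hLa : ∀ t, L t = S * t := fun t => by simp [L]
  have hpre : L ⁻¹' (Set.Ici ε) = Set.Ici (ε / S) := by
    ext t
    simp only [Set.mem_preimage, Set.mem_Ici, hLa]
    rw [div_le_iff₀' hS]
  have hu : UniqueDiffOn ℝ (L ⁻¹' (Set.Ici ε)) := hpre ▸ uniqueDiffOn_Ici _
  have hback : ∀ q, L (S⁻¹ • Φ q) = Φ q := fun q => by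
    rw [hLa, smul_eq_mul]; field_simp
  have heq : (fun q => f (Φ q)) = (f ∘ L) ∘ (fun q => S⁻¹ • Φ q) := by
    funext q
    simp only [Function.comp_apply, hback]
  have hgc : ContDiffOn ℝ (⊤ : ℕ∞) (f ∘ L) (L ⁻¹' (Set.Ici ε)) :=
    hf.comp L.contDiff.contDiffOn (fun _ h => h)
  have hin : ContDiff ℝ (⊤ : ℕ∞) (fun q => S⁻¹ • Φ q) := hΦ.const_smul _
  rw [heq, ← iteratedFDerivWithin_univ]
  apply norm_iteratedFDerivWithin_comp_le hgc hin.contDiffOn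
    (by exact_mod_cast le_top) hu uniqueDiffOn_univ _ (Set.mem_univ p)
  · intro i hi
    have hmem : L (S⁻¹ • Φ p) ∈ Set.Ici ε := by rw [hback]; exact hΦε p
    rw [L.iteratedFDerivWithin_comp_right hf (uniqueDiffOn_Ici ε) hu hmem
      (by exact_mod_cast le_top), hback]
    refine (ContinuousMultilinearMap.norm_compContinuousLinearMap_le _ _).trans ?_
    have hLn : ‖L‖ ≤ S := by
      apply L.opNorm_le_bound hS.le
      intro t
      rw [hLa, norm_mul, Real.norm_of_nonneg hS.le]
    rw [norm_iteratedFDerivWithin_eq_norm_iteratedDerivWithin]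
    simp only [Finset.prod_const, Finset.card_univ, Fintype.card_fin]
    have h0 : 0 ≤ K * S ^ (k - i) := (norm_nonneg _).trans (hK i hi)
    calc _ ≤ (K * S ^ (k - i)) * S ^ i := by
          gcongr
          exact hK i hi
      _ = K * S ^ k := by
          rw [mul_assoc, ← Real.rpow_natCast, ← Real.rpow_add hS]
          simp
  · intro i h1 h2
    rw [iteratedFDerivWithin_univ]
    have : iteratedFDeriv ℝ i (fun q => S⁻¹ • Φ q) p = S⁻¹ • iteratedFDeriv ℝ i Φ p :=
      iteratedFDeriv_const_smul_apply (a := S⁻¹) (x := p) (i := i) (hΦ.contDiffAt.of_le (by exact_mod_cast le_top))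
    rw [this, norm_smul, Real.norm_of_nonneg (inv_nonneg.2 hS.le)]
    rw [inv_mul_le_iff₀ hS, mul_comm S]
    exact hD i h1 h2
  · intro q _
    simp only [Set.mem_preimage, hback]
    exact hΦε q

end DirDeriv

theorem rpow_le_two (t c C p : ℝ) (hc : 0 < c) (h1 : c ≤ t) (h2 : t ≤ C) :
    t ^ p ≤ c ^ p + C ^ p := by
  have ht : 0 < t := hc.trans_le h1
  have a1 : 0 ≤ c ^ p := (Real.rpow_pos_of_pos hc p).le
  have a2 : 0 ≤ C ^ p := (Real.rpow_pos_of_pos (ht.trans_le h2) p).le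
  rcases le_total 0 p with hp | hp
  · have := Real.rpow_le_rpow ht.le h2 hp
    linarith
  · have := Real.rpow_le_rpow_of_nonpos hc h1 hp
    linarith

set_option maxHeartbeats 1000000 in
theorem statement1 (d N : ℕ) (hd : 0 < d) (hN : 0 < N) (m k μ ε : ℝ) (hm : 0 ≤ m)
    (hμ : 0 < μ) (hε : 0 < ε) (f : ℝ → ℂ)
    (hf : ContDiffOn ℝ (⊤ : ℕ∞) f (Set.Ici ε))
    (hfest : ∀ j : ℕ, ∃ C : ℝ, ∀ x : ℝ, ε ≤ x →
      ‖iteratedDerivWithin j f (Set.Ici ε) x‖ ≤ C * x ^ (k - j))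
    (a : EuclideanSpace ℝ (Fin d) → EuclideanSpace ℝ (Fin N) → ℝ)
    (ha : IsSymbol d N m a)
    (hlb : ∀ x ξ, ε ≤ a x ξ)
    (hell : ∀ x ξ, μ ≤ ‖ξ‖ → μ⁻¹ * jap ξ ^ m ≤ a x ξ) :
    IsSymbol d N (m * k) (fun x ξ => f (a x ξ)) := by
  obtain ⟨hsm, hest⟩ := ha
  have hcomp : ContDiff ℝ (⊤ : ℕ∞)
      (fun p : EuclideanSpace ℝ (Fin d) × EuclideanSpace ℝ (Fin N) => f (a p.1 p.2)) := by
    rw [← contDiffOn_univ]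
    exact hf.comp hsm.contDiffOn (fun p _ => hlb p.1 p.2)
  refine ⟨hcomp, fun j l => ?_⟩
  choose Ca hCa using hest
  choose Cf hCf using hfest
  -- lower bound
  obtain ⟨c, hc, hlow⟩ : ∃ c > 0, ∀ x ξ, c * jap ξ ^ m ≤ a x ξ := by
    set J : ℝ := ((1 + μ ^ 2) ^ ((1 : ℝ) / 2)) ^ m with hJ
    have hJpos : 0 < J := by positivity
    refine ⟨min μ⁻¹ (ε / J), by positivity, fun x ξ => ?_⟩
    have hjp : 0 ≤ jap ξ ^ m := Real.rpow_nonneg (zero_le_one.trans (one_le_jap ξ)) m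
    rcases le_total μ ‖ξ‖ with h | h
    · refine le_trans ?_ (hell x ξ h)
      gcongr
      exact min_le_left _ _
    · refine le_trans ?_ (hlb x ξ)
      have h1 : jap ξ ^ m ≤ J := by
        have h0 : (0 : ℝ) ≤ 1 + ‖ξ‖ ^ 2 := by positivity
        apply Real.rpow_le_rpow (zero_le_one.trans (one_le_jap ξ)) _ hm
        apply Real.rpow_le_rpow h0 _ (by norm_num)
        gcongr
      calc _ ≤ (ε / J) * J := by
            gcongr
            exact min_le_right _ _
        _ = ε := by field_simp
  -- upper bound
  have hup : ∀ x ξ, a x ξ ≤ Ca 0 0 * jap ξ ^ m := by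
    intro x ξ
    have := hCa 0 0 x ξ
    simp only [norm_iteratedFDeriv_zero, Nat.cast_zero, sub_zero] at this
    exact (Real.le_norm_self _).trans this
  set n := j + l with hn
  set K : ℝ := ∑ i ∈ Finset.range (n + 1), |Cf i| * (c ^ (k - i) + Ca 0 0 ^ (k - i)) with hKdef
  set Mf : ℕ → ℝ := fun i => ∑ q ∈ Finset.HasAntidiagonal.antidiagonal i, |Ca q.1 q.2| with hMf
  have hMf0 : ∀ i, 0 ≤ Mf i := fun i => Finset.sum_nonneg fun _ _ => abs_nonneg _
  set D : ℝ := 1 + ∑ i ∈ Finset.range (n + 1), 2 ^ i * Mf i with hDdef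
  have hDi : ∀ i ≤ n, 2 ^ i * Mf i ≤ ∑ i ∈ Finset.range (n + 1), 2 ^ i * Mf i := by
    intro i hi
    exact Finset.single_le_sum (f := fun i => 2 ^ i * Mf i)
      (fun i _ => mul_nonneg (by positivity) (hMf0 i)) (Finset.mem_range.2 (by omega))
  have hD1 : 1 ≤ D := by
    have := Finset.sum_nonneg (s := Finset.range (n + 1)) (f := fun i => 2 ^ i * Mf i)
      (fun i _ => mul_nonneg (by positivity) (hMf0 i))
    linarith
  refine ⟨n.factorial * K * D ^ n, fun x ξ => ?_⟩
  have hR : 0 < jap ξ := zero_lt_one.trans_le (one_le_jap ξ)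
  set R := jap ξ with hRdef
  have hS : 0 < R ^ m := Real.rpow_pos_of_pos hR m
  have hCpos : c ≤ Ca 0 0 := le_of_mul_le_mul_right ((hlow x ξ).trans (hup x ξ)) hS
  have hterm : ∀ i, 0 ≤ |Cf i| * (c ^ (k - i) + Ca 0 0 ^ (k - i)) := by
    intro i
    have h1 := Real.rpow_nonneg hc.le (k - i)
    have h2 := Real.rpow_nonneg (hc.le.trans hCpos) (k - i)
    positivity
  have hK0 : 0 ≤ K := Finset.sum_nonneg fun i _ => hterm i
  have hpt : (scl R : EuclideanSpace ℝ (Fin d) × EuclideanSpace ℝ (Fin N) →L[ℝ] _)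
      (x, R⁻¹ • ξ) = (x, ξ) := by
    simp [scl, smul_smul, hR.ne']
  have hbound : ‖iteratedFDeriv ℝ n (fun q => f (a (scl R q).1 (scl R q).2)) (x, R⁻¹ • ξ)‖
      ≤ n.factorial * (K * (R ^ m) ^ k) * D ^ n := by
    refine comp_bound ε k hε f hf n (R ^ m) hS (fun q => a (scl R q).1 (scl R q).2)
      (hsm.comp (scl R : EuclideanSpace ℝ (Fin d) × EuclideanSpace ℝ (Fin N) →L[ℝ]
        EuclideanSpace ℝ (Fin d) × EuclideanSpace ℝ (Fin N)).contDiff) (fun q => hlb _ _) (x, R⁻¹ • ξ) K D ?_ ?_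
    · intro i hi
      simp only [hpt]
      refine (hCf i _ (hlb x ξ)).trans ?_
      have hax : 0 < a x ξ := hε.trans_le (hlb x ξ)
      set t := a x ξ / R ^ m with ht
      have hat : a x ξ = t * R ^ m := by rw [ht]; field_simp
      have ht1 : c ≤ t := by rw [ht, le_div_iff₀ hS]; exact hlow x ξ
      have ht2 : t ≤ Ca 0 0 := by rw [ht, div_le_iff₀ hS]; exact hup x ξ
      have ht0 : 0 < t := hc.trans_le ht1
      have hSp := (Real.rpow_pos_of_pos hS (k - i)).le
      rw [hat, Real.mul_rpow ht0.le hS.le, ← mul_assoc]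
      gcongr
      calc Cf i * t ^ (k - i) ≤ |Cf i| * (c ^ (k - i) + Ca 0 0 ^ (k - i)) := by
            have := Real.rpow_nonneg ht0.le (k - i)
            gcongr
            · exact le_abs_self _
            · exact rpow_le_two t c _ _ hc ht1 ht2
        _ ≤ K := Finset.single_le_sum
            (f := fun i : ℕ => |Cf i| * (c ^ (k - i) + Ca 0 0 ^ (k - i)))
            (fun i _ => hterm i) (Finset.mem_range.2 (by omega))
    · intro i h1 hi
      refine (scale_in (a := a) hsm R hR i (Mf i * R ^ m) (mul_nonneg (hMf0 i) hS.le) x ξ ?_).trans ?_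
      · intro j' l' hjl
        have h2 := hCa j' l' x ξ
        have h3 : |Ca j' l'| ≤ Mf i := Finset.single_le_sum
          (f := fun q : ℕ × ℕ => |Ca q.1 q.2|) (a := (j', l'))
          (fun q _ => abs_nonneg _) (Finset.HasAntidiagonal.mem_antidiagonal.2 hjl)
        have h4 : R ^ (m - l') * R ^ l' = R ^ m := by
          rw [← Real.rpow_natCast, ← Real.rpow_add hR]
          simp
        calc _ ≤ (Ca j' l' * R ^ (m - l')) * R ^ l' := by gcongr
          _ = Ca j' l' * R ^ m := by rw [mul_assoc, h4]
          _ ≤ Mf i * R ^ m := by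
            gcongr
            exact (le_abs_self _).trans h3
      · rw [← mul_assoc]
        gcongr
        have h5 : D ≤ D ^ i := le_self_pow₀ hD1 (by omega)
        have := hDi i hi
        linarith
  have hD0 : 0 ≤ D := zero_le_one.trans hD1
  have hSk := (Real.rpow_pos_of_pos hS k).le
  refine (scale_out (a := fun x ξ => f (a x ξ)) hcomp R hR j l _ (by positivity) x ξ hbound).trans (le_of_eq ?_)
  rw [← Real.rpow_mul hR.le, Real.rpow_sub hR, Real.rpow_natCast, inv_pow, div_eq_mul_inv]
  ring
end
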